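/- Instrumental variables setting: let Z : Ω → {0, 1} be a binary instrument, D(0), D(1) : Ω → {0, 1} potential treatments with D := Z·D(1) + (1 − Z)·D(0), Y(0), Y(1) : Ω → {0, 1} potential outcomes with Y := D·Y(1) + (1 − D)·Y(0), and R : Ω → ℛ the remotely sensed variable. Suppose: (Instrument randomization) under P(·|S = e), Z is independent of (D(0), D(1), Y(0), Y(1)); (Instrument overlap) 0 < P(Z = 1 | S = e) < 1; (Monotonicity) P(D(1) ≥ D(0) | S = e) = 1 and P(D(1) > D(0) | S = e) > 0; (Positivity) P(S = e, D = d, Z = z, Y = y) > 0 for all d, z, y ∈ {0, 1} and P(S = o, Y = y) > 0 for all y ∈ {0, 1}; (Stability) R is conditionally independent of S given (Z, D, Y); (No direct effect) R is conditionally independent of the pair (Z, D) given Y. Define α(d, z) := E[Y | S = e, D = d, Z = z], Δᵉ(d, z) := 1{D = d, Z = z, S = e}/P(D = d, Z = z, S = e) − 1{Y = 0, S = o}/P(Y = 0, S = o) and Δᵒ := 1{Y = 1, S = o}/P(Y = 1, S = o) − 1{Y = 0, S = o}/P(Y = 0, S = o). Then for every z, d ∈ {0, 1} and every bounded measurable representation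 H : ℛ → ℝ with E[H(R)·Δᵒ] ≠ 0, one has α(d, z) = E[H(R)·Δᵉ(d, z)] / E[H(R)·Δᵒ]. -/

import Mathlib

open MeasureTheory ProbabilityTheory

noncomputable section

/-- Sample indicator values: experimental (`e`) or observational (`o`). -/
inductive Sample : Type
  | e
  | o
deriving DecidableEq

instance : MeasurableSpace Sample := ⊤

/-- Real-valued indicator of a boolean (`{0,1}`-valued variable). -/
def b2r (b : Bool) : ℝ := if b then 1 else 0

/-- `CondIndepOf P R V W` : the conditional law of `R` given `V = v, W = w` agrees with
the conditional law of `R` given `V = v`, for all values with positive probability;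
this is the notion of "R is conditionally independent of W given V" for variables with
countable ranges. -/
def CondIndepOf {Ω 𝓡 V W : Type*} [MeasurableSpace Ω] [MeasurableSpace 𝓡]
    (P : Measure Ω) (R : Ω → 𝓡) (Vf : Ω → V) (Wf : Ω → W) : Prop :=
  ∀ v w, 0 < P {ω | Vf ω = v ∧ Wf ω = w} →
    (P[|{ω | Vf ω = v ∧ Wf ω = w}]).map R = (P[|{ω | Vf ω = v}]).map R

instance : Fintype Sample := ⟨{.e, .o}, by rintro (_ | _) <;> simp⟩

lemma integral_eq_sum_setIntegral_fiber {Ω ι : Type*} [MeasurableSpace Ω] [Fintype ι]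
    [MeasurableSpace ι] [MeasurableSingletonClass ι] {P : Measure Ω} {X : Ω → ι}
    (hX : Measurable X) {F : Ω → ℝ} (hF : Integrable F P) :
    ∫ ω, F ω ∂P = ∑ x, ∫ ω in X ⁻¹' {x}, F ω ∂P := by
  rw [← integral_iUnion_fintype (fun x => hX (measurableSet_singleton x))
    (fun x y hxy => Disjoint.preimage X (by simpa using hxy))
    (fun x => hF.integrableOn), ← Set.preimage_iUnion,
    Set.iUnion_of_singleton, Set.preimage_univ, setIntegral_univ]

/-- If `F` integrates over each fiber of `X` like `m ∘ X`, then it does so against every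
function of `X`. -/
lemma integral_mul_comp_eq_of_fiber {Ω ι : Type*} [MeasurableSpace Ω] [Fintype ι]
    [MeasurableSpace ι] [MeasurableSingletonClass ι] {P : Measure Ω} [IsFiniteMeasure P]
    {X : Ω → ι} (hX : Measurable X) {F : Ω → ℝ} (hF : Integrable F P) {m : ι → ℝ}
    (hm : ∀ x, ∫ ω in X ⁻¹' {x}, F ω ∂P = P.real (X ⁻¹' {x}) * m x) (g : ι → ℝ) :
    ∫ ω, F ω * g (X ω) ∂P = ∫ ω, m (X ω) * g (X ω) ∂P := by
  have hint (f : ι → ℝ) : ∃ C, ∀ᵐ ω ∂P, ‖f (X ω)‖ ≤ C :=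
    ⟨∑ x, ‖f x‖, .of_forall fun ω =>
      Finset.single_le_sum (f := fun x => ‖f x‖) (fun _ _ => norm_nonneg _) (Finset.mem_univ _)⟩
  have hmeas (f : ι → ℝ) : AEStronglyMeasurable (fun ω => f (X ω)) P :=
    ((measurable_of_finite f).comp hX).aestronglyMeasurable
  obtain ⟨C, hC⟩ := hint g
  obtain ⟨C', hC'⟩ := hint fun x => m x * g x
  rw [integral_eq_sum_setIntegral_fiber hX (hF.mul_bdd (hmeas g) hC),
    integral_eq_sum_setIntegral_fiber hX (.of_bound (hmeas fun x => m x * g x) C' hC')]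
  refine Finset.sum_congr rfl fun x _ => ?_
  have hs : MeasurableSet (X ⁻¹' {x}) := hX (measurableSet_singleton x)
  rw [setIntegral_congr_fun (g := fun ω => F ω * g x) hs, integral_mul_const, hm,
    setIntegral_congr_fun (g := fun _ => m x * g x) hs, setIntegral_const, smul_eq_mul, mul_assoc]
  all_goals
    intro ω hω
    obtain rfl : X ω = x := hω
    rfl

lemma integral_cond_eq {Ω : Type*} [MeasurableSpace Ω] (P : Measure Ω) (A : Set Ω) (F : Ω → ℝ) :
    ∫ ω, F ω ∂P[|A] = (P.real A)⁻¹ * ∫ ω in A, F ω ∂P := by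
  rw [ProbabilityTheory.cond, integral_smul_measure, smul_eq_mul, ENNReal.toReal_inv, Measure.real]

/-- Under stability and no direct effect, the conditional mean of `H(R)` on a cell of
`(S, Z, D, Y)` depends only on the value of `Y`. -/
lemma setIntegral_cell_eq {Ω 𝓡 σ ζ δ υ : Type*} [MeasurableSpace Ω] [MeasurableSpace 𝓡]
    {P : Measure Ω} [IsFiniteMeasure P]
    {S : Ω → σ} {Z : Ω → ζ} {D : Ω → δ} {Y : Ω → υ} {R : Ω → 𝓡} (hR : Measurable R)
    (stability : CondIndepOf P R (fun ω => (Z ω, D ω, Y ω)) S)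
    (noDirectEffect : CondIndepOf P R Y (fun ω => (Z ω, D ω)))
    {H : 𝓡 → ℝ} (hH : Measurable H) (x : σ × ζ × δ × υ) :
    ∫ ω in (fun ω => (S ω, Z ω, D ω, Y ω)) ⁻¹' {x}, H (R ω) ∂P =
      P.real ((fun ω => (S ω, Z ω, D ω, Y ω)) ⁻¹' {x}) *
        ∫ ω, H (R ω) ∂P[|{ω | Y ω = x.2.2.2}] := by
  obtain ⟨s, z, d, y⟩ := x
  set A := (fun ω => (S ω, Z ω, D ω, Y ω)) ⁻¹' {(s, z, d, y)} with hA
  rcases eq_or_ne (P A) 0 with h0 | h0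
  · rw [setIntegral_measure_zero _ h0, Measure.real, h0, ENNReal.toReal_zero, zero_mul]
  have e₁ : {ω | (Z ω, D ω, Y ω) = (z, d, y) ∧ S ω = s} = A := by
    ext ω; simp [hA]; tauto
  have e₂ : {ω | Y ω = y ∧ (Z ω, D ω) = (z, d)} = {ω | (Z ω, D ω, Y ω) = (z, d, y)} := by
    ext ω; simp; tauto
  have h₁ := stability (z, d, y) s (by rw [e₁]; exact pos_iff_ne_zero.mpr h0)
  have h₂ := noDirectEffect y (z, d) (by
    refine (pos_iff_ne_zero.mpr h0).trans_le (measure_mono ?_)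
    rw [e₂, ← e₁]
    exact fun ω hω => hω.1)
  rw [e₁] at h₁
  rw [e₂, ← h₁] at h₂
  have key : ∫ ω, H (R ω) ∂P[|A] = ∫ ω, H (R ω) ∂P[|{ω | Y ω = y}] := by
    rw [← integral_map hR.aemeasurable hH.aestronglyMeasurable, h₂,
      integral_map hR.aemeasurable hH.aestronglyMeasurable]
  have hne : P.real A ≠ 0 := (measureReal_ne_zero_iff).mpr h0
  rw [← key, integral_cond_eq, mul_inv_cancel_left₀ hne]

lemma integral_ite_div_measureReal {Ω : Type*} [MeasurableSpace Ω] {P : Measure Ω}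
    {p : Ω → Prop} [DecidablePred p] (hp : MeasurableSet {ω | p ω}) (f : Ω → ℝ) :
    ∫ ω, f ω * ((if p ω then 1 else 0) / (P {ω | p ω}).toReal) ∂P =
      ∫ ω, f ω ∂P[|{ω | p ω}] := by
  rw [integral_cond_eq, ← integral_indicator hp, ← integral_const_mul]
  refine integral_congr_ae (.of_forall fun ω => ?_)
  by_cases h : p ω <;> simp [Set.indicator, h, Measure.real, div_eq_mul_inv, mul_comm]

/-- **Corollary (Representation with an instrument).** For every `z, d ∈ {0,1}` and
every bounded measurable `H : ℛ → ℝ` with `E[H(R)·Δᵒ] ≠ 0`,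
`α(d,z) = E[H(R)·Δᵉ(d,z)] / E[H(R)·Δᵒ]`. -/
theorem statement18
    {Ω 𝓡 : Type*} [MeasurableSpace Ω] [MeasurableSpace 𝓡] [StandardBorelSpace 𝓡]
    (P : Measure Ω) [IsProbabilityMeasure P]
    (S : Ω → Sample) (Z : Ω → Bool) (D0 D1 : Ω → Bool) (Y0 Y1 : Ω → Bool) (R : Ω → 𝓡)
    (hS : Measurable S) (hZ : Measurable Z) (hD0 : Measurable D0) (hD1 : Measurable D1)
    (hY0 : Measurable Y0) (hY1 : Measurable Y1) (hR : Measurable R)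
    (D : Ω → Bool) (hDdef : ∀ ω, D ω = if Z ω then D1 ω else D0 ω)
    (Y : Ω → Bool) (hYdef : ∀ ω, Y ω = if D ω then Y1 ω else Y0 ω)
    -- Instrument randomization: Z ⫫ (D(0), D(1), Y(0), Y(1)) under P(·|S = e)
    (instRandomization : IndepFun Z (fun ω => (D0 ω, D1 ω, Y0 ω, Y1 ω))
      (P[|{ω | S ω = Sample.e}]))
    -- Instrument overlap: 0 < P(Z = 1 | S = e) < 1
    (overlap₀ : 0 < (P[|{ω | S ω = Sample.e}]) {ω | Z ω = true})
    (overlap₁ : (P[|{ω | S ω = Sample.e}]) {ω | Z ω = true} < 1)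
    -- Monotonicity
    (mono : (P[|{ω | S ω = Sample.e}]) {ω | D0 ω ≤ D1 ω} = 1)
    (compliers : 0 < (P[|{ω | S ω = Sample.e}]) {ω | D0 ω < D1 ω})
    -- Positivity
    (positivity_e : ∀ d z y : Bool,
      0 < P {ω | S ω = Sample.e ∧ D ω = d ∧ Z ω = z ∧ Y ω = y})
    (positivity_o : ∀ y : Bool, 0 < P {ω | S ω = Sample.o ∧ Y ω = y})
    -- Stability: R ⫫ S | (Z, D, Y)
    (stability : CondIndepOf P R (fun ω => (Z ω, D ω, Y ω)) S)
    -- No direct effect: R ⫫ (Z, D) | Y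
    (noDirectEffect : CondIndepOf P R Y (fun ω => (Z ω, D ω)))
    (d z : Bool)
    -- α(d, z) := E[Y | S = e, D = d, Z = z]
    (α : ℝ)
    (hα : α = ∫ ω, b2r (Y ω)
      ∂(P[|{ω | S ω = Sample.e ∧ D ω = d ∧ Z ω = z}]))
    -- Δᵉ(d, z) := 1{D=d,Z=z,S=e}/P(D=d,Z=z,S=e) − 1{Y=0,S=o}/P(Y=0,S=o)
    (Δe : Ω → ℝ)
    (hΔe : ∀ ω, Δe ω =
      (if D ω = d ∧ Z ω = z ∧ S ω = Sample.e then (1 : ℝ) else 0) /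
        (P {ω' | D ω' = d ∧ Z ω' = z ∧ S ω' = Sample.e}).toReal -
      (if Y ω = false ∧ S ω = Sample.o then (1 : ℝ) else 0) /
        (P {ω' | Y ω' = false ∧ S ω' = Sample.o}).toReal)
    -- Δᵒ := 1{Y=1,S=o}/P(Y=1,S=o) − 1{Y=0,S=o}/P(Y=0,S=o)
    (Δo : Ω → ℝ)
    (hΔo : ∀ ω, Δo ω =
      (if Y ω = true ∧ S ω = Sample.o then (1 : ℝ) else 0) /
        (P {ω' | Y ω' = true ∧ S ω' = Sample.o}).toReal -
      (if Y ω = false ∧ S ω = Sample.o then (1 : ℝ) else 0) /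
        (P {ω' | Y ω' = false ∧ S ω' = Sample.o}).toReal) :
    ∀ H : 𝓡 → ℝ, Measurable H → (∃ C : ℝ, ∀ r, |H r| ≤ C) →
      (∫ ω, H (R ω) * Δo ω ∂P) ≠ 0 →
      α = (∫ ω, H (R ω) * Δe ω ∂P) / (∫ ω, H (R ω) * Δo ω ∂P) := by
  intro H hH ⟨C, hC⟩ hne
  have hD : Measurable D := by
    rw [funext hDdef]
    exact Measurable.ite (hZ (measurableSet_singleton true)) hD1 hD0
  have hY : Measurable Y := by
    rw [funext hYdef]
    exact Measurable.ite (hD (measurableSet_singleton true)) hY1 hY0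
  have hX : Measurable fun ω => (S ω, Z ω, D ω, Y ω) :=
    hS.prodMk (hZ.prodMk (hD.prodMk hY))
  have hset (p : Sample × Bool × Bool × Bool → Prop) :
      MeasurableSet {ω | p (S ω, Z ω, D ω, Y ω)} :=
    hX (Set.toFinite {x | p x}).measurableSet
  have hint (f : Sample × Bool × Bool × Bool → ℝ) :
      Integrable (fun ω => f (S ω, Z ω, D ω, Y ω)) P :=
    .of_bound ((measurable_of_finite f).comp hX).aestronglyMeasurable (∑ x, ‖f x‖)
      (.of_forall fun ω => Finset.single_le_sum (f := fun x => ‖f x‖)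
        (fun _ _ => norm_nonneg _) (Finset.mem_univ _))
  set m : Bool → ℝ := fun y => ∫ ω, H (R ω) ∂P[|{ω | Y ω = y}] with hm
  have hFi : Integrable (fun ω => H (R ω)) P :=
    .of_bound (hH.comp hR).aestronglyMeasurable C (.of_forall fun ω => hC _)
  have transfer (g : Sample × Bool × Bool × Bool → ℝ) :
      ∫ ω, H (R ω) * g (S ω, Z ω, D ω, Y ω) ∂P = ∫ ω, m (Y ω) * g (S ω, Z ω, D ω, Y ω) ∂P :=
    integral_mul_comp_eq_of_fiber (m := fun x => m x.2.2.2) hX hFi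
      (setIntegral_cell_eq hR stability noDirectEffect hH) g
  have obs (y : Bool) : ∫ ω, m (Y ω) * ((if Y ω = y ∧ S ω = Sample.o then (1 : ℝ) else 0) /
      (P {ω' | Y ω' = y ∧ S ω' = Sample.o}).toReal) ∂P = m y := by
    have hs := hset fun x => x.2.2.2 = y ∧ x.1 = Sample.o
    have hpos : P {ω | Y ω = y ∧ S ω = Sample.o} ≠ 0 := by
      simpa only [and_comm] using (positivity_o y).ne'
    have := cond_isProbabilityMeasure hpos
    rw [integral_ite_div_measureReal hs, integral_congr_ae (g := fun _ => m y)]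
    · simp
    · filter_upwards [ae_cond_mem hs] with ω hω
      rw [hω.1]
  have exper : ∫ ω, m (Y ω) * ((if D ω = d ∧ Z ω = z ∧ S ω = Sample.e then (1 : ℝ) else 0) /
      (P {ω' | D ω' = d ∧ Z ω' = z ∧ S ω' = Sample.e}).toReal) ∂P =
      m false + (m true - m false) * α := by
    have hs := hset fun x => x.2.2.1 = d ∧ x.2.1 = z ∧ x.1 = Sample.e
    have e : {ω | S ω = Sample.e ∧ D ω = d ∧ Z ω = z} =
        {ω | D ω = d ∧ Z ω = z ∧ S ω = Sample.e} := by
      ext ω; simp only [Set.mem_ofPred_eq]; tauto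
    have hpos : P {ω | D ω = d ∧ Z ω = z ∧ S ω = Sample.e} ≠ 0 := by
      refine ((positivity_e d z true).trans_le (measure_mono ?_)).ne'
      exact fun ω hω => ⟨hω.2.1, hω.2.2.1, hω.1⟩
    have := cond_isProbabilityMeasure hpos
    have hb : Integrable (fun ω => b2r (Y ω)) P[|{ω | D ω = d ∧ Z ω = z ∧ S ω = Sample.e}] :=
      .of_bound ((measurable_of_finite b2r).comp hY).aestronglyMeasurable 1
        (.of_forall fun ω => by cases Y ω <;> simp [b2r])
    have hmb (y : Bool) : m y = m false + (m true - m false) * b2r y := by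
      cases y <;> simp [b2r]
    rw [integral_ite_div_measureReal hs, hα, e, integral_congr_ae (.of_forall fun ω => hmb (Y ω)),
      integral_add (integrable_const _) (hb.const_mul _), integral_const_mul]
    simp
  have hΔoE : ∫ ω, H (R ω) * Δo ω ∂P = m true - m false := by
    simp only [hΔo]
    rw [transfer fun x => (if x.2.2.2 = true ∧ x.1 = Sample.o then (1 : ℝ) else 0) /
        (P {ω' | Y ω' = true ∧ S ω' = Sample.o}).toReal -
      (if x.2.2.2 = false ∧ x.1 = Sample.o then (1 : ℝ) else 0) /
        (P {ω' | Y ω' = false ∧ S ω' = Sample.o}).toReal]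
    simp only [mul_sub]
    rw [integral_sub, obs, obs]
    · exact hint fun x => m x.2.2.2 * ((if x.2.2.2 = true ∧ x.1 = Sample.o then (1 : ℝ) else 0) /
        (P {ω' | Y ω' = true ∧ S ω' = Sample.o}).toReal)
    · exact hint fun x => m x.2.2.2 * ((if x.2.2.2 = false ∧ x.1 = Sample.o then (1 : ℝ) else 0) /
        (P {ω' | Y ω' = false ∧ S ω' = Sample.o}).toReal)
  have hΔeE : ∫ ω, H (R ω) * Δe ω ∂P = α * (m true - m false) := by
    simp only [hΔe]
    rw [transfer fun x =>
      (if x.2.2.1 = d ∧ x.2.1 = z ∧ x.1 = Sample.e then (1 : ℝ) else 0) /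
        (P {ω' | D ω' = d ∧ Z ω' = z ∧ S ω' = Sample.e}).toReal -
      (if x.2.2.2 = false ∧ x.1 = Sample.o then (1 : ℝ) else 0) /
        (P {ω' | Y ω' = false ∧ S ω' = Sample.o}).toReal]
    simp only [mul_sub]
    rw [integral_sub, exper, obs]
    · ring
    · exact hint fun x => m x.2.2.2 *
        ((if x.2.2.1 = d ∧ x.2.1 = z ∧ x.1 = Sample.e then (1 : ℝ) else 0) /
        (P {ω' | D ω' = d ∧ Z ω' = z ∧ S ω' = Sample.e}).toReal)
    · exact hint fun x => m x.2.2.2 * ((if x.2.2.2 = false ∧ x.1 = Sample.o then (1 : ℝ) else 0) /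
        (P {ω' | Y ω' = false ∧ S ω' = Sample.o}).toReal)
  rw [hΔoE] at hne
  rw [hΔeE, hΔoE, mul_div_cancel_right₀ _ hne]
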